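/- Let H be the anti-chain order on [n] (i ⪯_H j iff i = j) and F_2 the field with two elements, so that d_H is the Hamming metric. Let C ⊆ F_2^n be a linear code and (C; C_0; C_1,...,C_r) a maximal decomposition of C (one admitting no refinement as a decomposition). If T is a linear H-isometry with T(C) = C', then (C'; T(C_0); T(C_1),...,T(C_r)) is a maximal decomposition of C'; consequently, a maximal decomposition of C is also a maximal H-decomposition of C. -/

import Mathlib

/-- `I` is an ideal of the poset `P` on `[n]`. -/
def IsPosetIdeal {n : ℕ} (P : PartialOrder (Fin n)) (I : Set (Fin n)) : Prop :=
  ∀ i ∈ I, ∀ j, P.le j i → j ∈ I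

/-- The smallest ideal of `P` containing `X`. -/
def idealGen {n : ℕ} (P : PartialOrder (Fin n)) (X : Set (Fin n)) : Set (Fin n) :=
  ⋂₀ {I | IsPosetIdeal P I ∧ X ⊆ I}

/-- The `P`-weight `ω_P(x) = |⟨supp(x)⟩|`. -/
noncomputable def posetWeight {F : Type*} [Field F] {n : ℕ} (P : PartialOrder (Fin n))
    (x : Fin n → F) : ℕ :=
  (idealGen P {i | x i ≠ 0}).ncard

/-- The `P`-distance `d_P(x,y) = ω_P(x - y)`. -/
noncomputable def posetDist {F : Type*} [Field F] {n : ℕ} (P : PartialOrder (Fin n))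
    (x y : Fin n → F) : ℕ :=
  posetWeight P (x - y)

/-- A linear `P`-isometry of `F_q^n`. -/
def IsPIsometry {F : Type*} [Field F] {n : ℕ} (P : PartialOrder (Fin n))
    (T : (Fin n → F) ≃ₗ[F] (Fin n → F)) : Prop :=
  ∀ x y, posetDist P (T x) (T y) = posetDist P x y

/-- The support of a subspace `D ⊆ F_q^n`. -/
def suppS {F : Type*} [Field F] {n : ℕ} (D : Submodule F (Fin n → F)) : Set (Fin n) :=
  {j | ∃ x ∈ D, x j ≠ 0}

/-- `C_0`: the subspace of all vectors vanishing on the support of `C`. -/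
def coSupp {F : Type*} [Field F] {n : ℕ} (C : Submodule F (Fin n → F)) :
    Submodule F (Fin n → F) where
  carrier := {x | ∀ j ∈ suppS C, x j = 0}
  add_mem' := by
    intro a b ha hb j hj
    simp only [Set.mem_setOf_eq] at ha hb ⊢
    rw [Pi.add_apply, ha j hj, hb j hj, add_zero]
  zero_mem' := by intro j _; rfl
  smul_mem' := by
    intro c a ha j hj
    simp only [Set.mem_setOf_eq] at ha ⊢
    rw [Pi.smul_apply, ha j hj, smul_zero]

/-- A decomposition `(C; C_0; C_1, …, C_r)` of a linear code `C ⊆ F_q^n`: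
nonzero subspaces `C_1, …, C_r` with pairwise disjoint supports whose internal
direct sum is `C`.  (The distinguished part `C_0 = coSupp C` is determined by `C`.) -/
structure Decomposition {F : Type*} [Field F] {n : ℕ} (C : Submodule F (Fin n → F)) where
  r : ℕ
  D : Fin r → Submodule F (Fin n → F)
  ne_bot : ∀ i, D i ≠ ⊥
  indep : iSupIndep D
  sup_eq : ⨆ i, D i = C
  disj : Pairwise fun i j => Disjoint (suppS (D i)) (suppS (D j))

/-- A `P`-decomposition of `C`: a decomposition of a code `C'` that is
`P`-equivalent to `C`. -/
structure PDecomposition {F : Type*} [Field F] {n : ℕ} (P : PartialOrder (Fin n))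
    (C : Submodule F (Fin n → F)) where
  C' : Submodule F (Fin n → F)
  T : (Fin n → F) ≃ₗ[F] (Fin n → F)
  isom : IsPIsometry P T
  image : Submodule.map (T : (Fin n → F) →ₗ[F] (Fin n → F)) C = C'
  dec : Decomposition C'

/-- A trivial `P`-decomposition of `C`: a single component, with
`|supp(C')| = |supp(C)|` and `|supp(C'_0)| = |supp(C_0)|`. -/
def PDecomposition.IsTrivial {F : Type*} [Field F] {n : ℕ} {P : PartialOrder (Fin n)}
    {C : Submodule F (Fin n → F)} (d : PDecomposition P C) : Prop :=
  d.dec.r = 1 ∧ (suppS d.C').ncard = (suppS C).ncard ∧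
    (suppS (coSupp d.C')).ncard = (suppS (coSupp C)).ncard

/-- A code is `P`-irreducible if it admits no non-trivial `P`-decomposition. -/
def PIrreducible {F : Type*} [Field F] {n : ℕ} (P : PartialOrder (Fin n))
    (C : Submodule F (Fin n → F)) : Prop :=
  ∀ d : PDecomposition P C, d.IsTrivial

/-- A `P`-decomposition is maximal if each of its components is `P`-irreducible. -/
def PDecomposition.IsMaximal {F : Type*} [Field F] {n : ℕ} {P : PartialOrder (Fin n)}
    {C : Submodule F (Fin n → F)} (d : PDecomposition P C) : Prop :=
  ∀ i, PIrreducible P (d.dec.D i)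

/-- A pointed partition `(J_0; J_1, …, J_r)` of `[n]`: pairwise disjoint parts
covering `[n]`, where only the distinguished part `J0` may be empty.  Since the
parts `J_1, …, J_r` are nonempty and pairwise disjoint (hence pairwise distinct,
their order being irrelevant), they are recorded as a finite set of finsets. -/
structure PointedPartition (n : ℕ) where
  J0 : Finset (Fin n)
  parts : Finset (Finset (Fin n))
  nonempty : ∀ J ∈ parts, J.Nonempty
  disj0 : ∀ J ∈ parts, Disjoint J0 J
  disj : ∀ J ∈ parts, ∀ K ∈ parts, J ≠ K → Disjoint J K
  cover : J0 ∪ parts.sup id = Finset.univ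

/-- A 1-step refinement `Q` of `Pp`: either split one part into two nonempty parts
(an `l`-split), or move a nonempty proper subset of one part into the
distinguished part `J0` (an `l`-aggregate). -/
def OneStepRefinement {n : ℕ} (Q Pp : PointedPartition n) : Prop :=
  (∃ A ∈ Pp.parts, ∃ B C : Finset (Fin n), B.Nonempty ∧ C.Nonempty ∧
      Disjoint B C ∧ B ∪ C = A ∧ Q.J0 = Pp.J0 ∧
      Q.parts = insert B (insert C (Pp.parts.erase A))) ∨
  (∃ A ∈ Pp.parts, ∃ B : Finset (Fin n), B.Nonempty ∧ B ⊂ A ∧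
      Q.J0 = Pp.J0 ∪ B ∧ Q.parts = insert (A \ B) (Pp.parts.erase A))

/-- `Q` is a strict refinement of `Pp` if it is obtained from `Pp` by finitely
many 1-step refinements, at least one occurring. -/
def StrictRefines {n : ℕ} (Q Pp : PointedPartition n) : Prop :=
  Relation.TransGen OneStepRefinement Q Pp

/-- The pointed partition of `[n]` induced by a decomposition of a code `C`:
the distinguished part is `[n] \ supp(C)` and the other parts are the supports
of the components. -/
def IsInducedPartition {F : Type*} [Field F] {n : ℕ} {C : Submodule F (Fin n → F)}
    (d : Decomposition C) (pp : PointedPartition n) : Prop :=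
  (↑pp.J0 : Set (Fin n)) = (suppS C)ᶜ ∧
  ∀ s : Finset (Fin n), s ∈ pp.parts ↔ ∃ i, (↑s : Set (Fin n)) = suppS (d.D i)

/-- A decomposition is maximal if it admits no refinement, i.e. no decomposition
of the same code induces a pointed partition strictly refining its own. -/
def IsMaximalDecomposition {F : Type*} [Field F] {n : ℕ}
    {C : Submodule F (Fin n → F)} (d : Decomposition C) : Prop :=
  ∀ (d' : Decomposition C) (pp pp' : PointedPartition n),
    IsInducedPartition d pp → IsInducedPartition d' pp' → ¬ StrictRefines pp' pp

section Support

variable {F : Type*} [Field F] {n : ℕ}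

lemma mem_suppS_iff {D : Submodule F (Fin n → F)} {j : Fin n} :
    j ∈ suppS D ↔ ¬ D ≤ LinearMap.ker (LinearMap.proj j : (Fin n → F) →ₗ[F] F) := by
  simp [suppS, SetLike.le_def]

lemma suppS_iSup {ι : Sort*} (D : ι → Submodule F (Fin n → F)) :
    suppS (⨆ i, D i) = ⋃ i, suppS (D i) := by
  ext j
  simp only [Set.mem_iUnion, mem_suppS_iff, iSup_le_iff, not_forall]

lemma suppS_sup (A B : Submodule F (Fin n → F)) :
    suppS (A ⊔ B) = suppS A ∪ suppS B := by
  ext j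
  simp only [Set.mem_union, mem_suppS_iff, sup_le_iff, not_and_or]

lemma suppS_nonempty {D : Submodule F (Fin n → F)} (h : D ≠ ⊥) : (suppS D).Nonempty := by
  obtain ⟨x, hx, hx0⟩ := D.ne_bot_iff.1 h
  obtain ⟨j, hj⟩ := Function.ne_iff.1 hx0
  exact ⟨j, x, hx, hj⟩

lemma disjoint_of_disjoint_suppS {A B : Submodule F (Fin n → F)}
    (h : Disjoint (suppS A) (suppS B)) : Disjoint A B := by
  rw [Submodule.disjoint_def]
  intro x hA hB
  ext j
  by_contra hj
  exact Set.disjoint_left.1 h ⟨x, hA, hj⟩ ⟨x, hB, hj⟩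

lemma disjoint_suppS_biSup {ι : Type*} {D : ι → Submodule F (Fin n → F)}
    (h : Pairwise fun i j => Disjoint (suppS (D i)) (suppS (D j))) (i : ι) :
    Disjoint (suppS (D i)) (suppS (⨆ j, ⨆ _ : j ≠ i, D j)) := by
  simp only [suppS_iSup, Set.disjoint_iUnion_right]
  exact fun j hj => h hj.symm

lemma iSupIndep_of_disjoint_suppS {ι : Type*} {D : ι → Submodule F (Fin n → F)}
    (h : Pairwise fun i j => Disjoint (suppS (D i)) (suppS (D j))) : iSupIndep D :=
  fun i => disjoint_of_disjoint_suppS (disjoint_suppS_biSup h i)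

lemma suppS_coSupp (C : Submodule F (Fin n → F)) : suppS (coSupp C) = (suppS C)ᶜ := by
  ext j
  constructor
  · rintro ⟨x, hx, hj⟩ hjC
    exact hj (hx j hjC)
  · intro hj
    refine ⟨Pi.single j 1, fun k hk => ?_, by simp⟩
    rw [Pi.single_eq_of_ne]
    rintro rfl
    exact hj hk

lemma suppS_map {T : (Fin n → F) ≃ₗ[F] (Fin n → F)} {σ : Equiv.Perm (Fin n)}
    (hσ : ∀ x i, T x (σ i) = x i) (D : Submodule F (Fin n → F)) :
    suppS (D.map (T : (Fin n → F) →ₗ[F] (Fin n → F))) = σ '' suppS D := by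
  ext j
  obtain ⟨i, rfl⟩ := σ.surjective j
  constructor
  · rintro ⟨_, ⟨x, hx, rfl⟩, hj⟩
    exact ⟨i, ⟨x, hx, by simpa [hσ] using hj⟩, rfl⟩
  · rintro ⟨k, ⟨x, hx, hk⟩, hki⟩
    exact ⟨T x, Submodule.mem_map_of_mem hx, by simpa [← hki, hσ] using hk⟩

lemma symm_apply_perm_symm {T : (Fin n → F) ≃ₗ[F] (Fin n → F)} {σ : Equiv.Perm (Fin n)}
    (hσ : ∀ x i, T x (σ i) = x i) (x : Fin n → F) (i : Fin n) :
    T.symm x (σ.symm i) = x i := by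
  simpa using (hσ (T.symm x) (σ.symm i)).symm

end Support

section Isometry

lemma posetWeight_antichain {F : Type*} [Field F] {n : ℕ} {H : PartialOrder (Fin n)}
    (hH : ∀ i j : Fin n, H.le i j ↔ i = j) (x : Fin n → F) :
    posetWeight H x = {i | x i ≠ 0}.ncard := by
  have h (X : Set (Fin n)) : idealGen H X = X := by
    refine Set.Subset.antisymm (Set.sInter_subset_of_mem ⟨?_, subset_rfl⟩)
      (Set.subset_sInter fun _ hI => hI.2)
    rintro i hi j hji
    rwa [(hH j i).1 hji]
  rw [posetWeight, h]

lemma exists_perm_of_isPIsometry {n : ℕ} {H : PartialOrder (Fin n)}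
    (hH : ∀ i j : Fin n, H.le i j ↔ i = j)
    {T : (Fin n → ZMod 2) ≃ₗ[ZMod 2] (Fin n → ZMod 2)} (hT : IsPIsometry H T) :
    ∃ σ : Equiv.Perm (Fin n), ∀ x i, T x (σ i) = x i := by
  have hw (x) : {i | T x i ≠ 0}.ncard = {i | x i ≠ 0}.ncard := by
    simpa [posetDist, posetWeight_antichain hH] using hT x 0
  have hsingle (i : Fin n) :
      ∃ j, T (Pi.single i 1) = Pi.single j 1 := by
    have hi : {k | (Pi.single i 1 : Fin n → ZMod 2) k ≠ 0} = {i} := by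
      ext k
      simp [Pi.single_apply]
    have h1 := hw (Pi.single i 1)
    rw [hi, Set.ncard_singleton, Set.ncard_eq_one] at h1
    obtain ⟨j, hj⟩ := h1
    refine ⟨j, funext fun k => ?_⟩
    have hk := Set.ext_iff.1 hj k
    simp only [Set.mem_ofPred_eq, Set.mem_singleton_iff] at hk
    by_cases hkj : k = j
    · subst hkj
      rw [Pi.single_eq_same]
      exact Fin.eq_one_of_ne_zero _ (hk.2 rfl)
    · simpa [hkj] using hk
  choose σ hσ using hsingle
  have hinj : Function.Injective σ := fun i j hij => by
    have h : (Pi.single i 1 : Fin n → ZMod 2) = Pi.single j 1 :=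
      T.injective (by rw [hσ, hσ, hij])
    by_contra hne
    simpa [hne] using congrFun h i
  refine ⟨Equiv.ofBijective σ (Finite.injective_iff_bijective.1 hinj), fun x i => ?_⟩
  have hx : T x = ∑ k, x k • Pi.single (σ k) (1 : ZMod 2) := by
    conv_lhs => rw [pi_eq_sum_univ' x]
    simp only [map_sum, map_smul, ← hσ]
  simp [hx, Pi.single_apply, hinj.eq_iff]

end Isometry

section Decomposition

variable {F : Type*} [Field F] {n : ℕ} {C : Submodule F (Fin n → F)}

/-- A finite family of nonzero subspaces with pairwise disjoint supports is a decomposition of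
its supremum. -/
noncomputable def Decomposition.ofFintype {ι : Type*} [Fintype ι]
    (D : ι → Submodule F (Fin n → F)) (ne_bot : ∀ i, D i ≠ ⊥) (sup_eq : ⨆ i, D i = C)
    (disj : Pairwise fun i j => Disjoint (suppS (D i)) (suppS (D j))) : Decomposition C where
  r := Fintype.card ι
  D := D ∘ (Fintype.equivFin ι).symm
  ne_bot i := ne_bot _
  indep := iSupIndep_of_disjoint_suppS
    (disj.comp_of_injective (Fintype.equivFin ι).symm.injective)
  sup_eq := by rw [← sup_eq]; exact (Fintype.equivFin ι).symm.iSup_comp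
  disj := disj.comp_of_injective (Fintype.equivFin ι).symm.injective

/-- The image of a decomposition under a coordinate permutation. -/
def Decomposition.map {C' : Submodule F (Fin n → F)} (d : Decomposition C)
    (T : (Fin n → F) ≃ₗ[F] (Fin n → F)) (σ : Equiv.Perm (Fin n))
    (hσ : ∀ x i, T x (σ i) = x i)
    (hC : C.map (T : (Fin n → F) →ₗ[F] (Fin n → F)) = C') : Decomposition C' where
  r := d.r
  D i := (d.D i).map (T : (Fin n → F) →ₗ[F] (Fin n → F))
  ne_bot i := by
    rw [Ne, Submodule.map_eq_bot_iff]
    exact d.ne_bot i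
  indep := iSupIndep_of_disjoint_suppS fun i j hij => by
    simp only [suppS_map hσ, Set.disjoint_image_iff σ.injective]
    exact d.disj hij
  sup_eq := by rw [← Submodule.map_iSup, d.sup_eq, hC]
  disj i j hij := by
    simp only [suppS_map hσ, Set.disjoint_image_iff σ.injective]
    exact d.disj hij

lemma Decomposition.suppS_eq_iUnion (d : Decomposition C) :
    suppS C = ⋃ i, suppS (d.D i) := by
  rw [← suppS_iSup, d.sup_eq]

lemma Decomposition.eq_of_suppS_eq (d : Decomposition C) {i j : Fin d.r}
    (h : suppS (d.D i) = suppS (d.D j)) : i = j := by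
  by_contra hij
  have hdisj := d.disj hij
  simp only [h, disjoint_self] at hdisj
  exact (suppS_nonempty (d.ne_bot j)).ne_empty hdisj

lemma Decomposition.exists_isInducedPartition (d : Decomposition C) :
    ∃ pp : PointedPartition n, IsInducedPartition d pp := by
  classical
  refine ⟨{
    J0 := (suppS C)ᶜ.toFinset
    parts := Finset.univ.image fun i => (suppS (d.D i)).toFinset
    nonempty := ?_
    disj0 := ?_
    disj := ?_
    cover := ?_ }, by simp, fun s => ?_⟩
  · simp only [Finset.mem_image, Finset.mem_univ, true_and]
    rintro _ ⟨i, rfl⟩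
    simpa using suppS_nonempty (d.ne_bot i)
  · simp only [Finset.mem_image, Finset.mem_univ, true_and]
    rintro _ ⟨i, rfl⟩
    rw [Set.disjoint_toFinset, d.suppS_eq_iUnion]
    exact Set.disjoint_compl_left_iff_subset.2 (Set.subset_iUnion (fun i => suppS (d.D i)) i)
  · simp only [Finset.mem_image, Finset.mem_univ, true_and]
    rintro _ ⟨i, rfl⟩ _ ⟨j, rfl⟩ hij
    rw [Set.disjoint_toFinset]
    exact d.disj fun h => hij (by rw [h])
  · ext j
    have hj : j ∈ suppS C ↔ ∃ i, j ∈ suppS (d.D i) := by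
      rw [d.suppS_eq_iUnion, Set.mem_iUnion]
    simp only [Finset.mem_union, Finset.mem_sup, Finset.mem_image, Finset.mem_univ, true_and,
      id, Set.mem_toFinset, Set.mem_compl_iff, hj, iff_true, exists_exists_eq_and]
    exact (em _).symm
  · simp only [Finset.mem_image, Finset.mem_univ, true_and]
    refine exists_congr fun i => ?_
    rw [← Finset.coe_inj, Set.coe_toFinset, eq_comm]

lemma IsMaximalDecomposition.not_exists_split {d : Decomposition C}
    (hd : IsMaximalDecomposition d) (i : Fin d.r) {A B : Submodule F (Fin n → F)}
    (hA : A ≠ ⊥) (hB : B ≠ ⊥) (hAB : A ⊔ B = d.D i)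
    (hdisj : Disjoint (suppS A) (suppS B)) : False := by
  classical
  have hsupp : suppS (d.D i) = suppS A ∪ suppS B := by rw [← hAB, suppS_sup]
  have hdA (j) (hj : j ≠ i) : Disjoint (suppS A) (suppS (d.D j)) :=
    (d.disj hj.symm).mono_left (hsupp ▸ Set.subset_union_left)
  have hdB (j) (hj : j ≠ i) : Disjoint (suppS B) (suppS (d.D j)) :=
    (d.disj hj.symm).mono_left (hsupp ▸ Set.subset_union_right)
  let E : Option (Fin d.r) → Submodule F (Fin n → F) :=
    fun o => o.elim B (Function.update d.D i A)
  have hEi : E (some i) = A := Function.update_self ..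
  have hEj (j) (hj : j ≠ i) : E (some j) = d.D j := Function.update_of_ne hj ..
  have hE0 : E none = B := rfl
  let e : Decomposition C := .ofFintype E
    (by
      rintro (_ | j)
      · exact hB
      · by_cases hj : j = i
        · rw [hj, hEi]; exact hA
        · rw [hEj j hj]; exact d.ne_bot j)
    (by
      refine Eq.trans ?_ d.sup_eq
      apply le_antisymm
      · refine iSup_le ?_
        rintro (_ | j)
        · exact le_iSup_of_le i (hAB ▸ le_sup_right)
        · by_cases hj : j = i
          · rw [hj, hEi]; exact le_iSup_of_le i (hAB ▸ le_sup_left)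
          · rw [hEj j hj]; exact le_iSup d.D j
      · refine iSup_le fun j => ?_
        by_cases hj : j = i
        · rw [hj, ← hAB]
          exact sup_le (hEi ▸ le_iSup E (some i)) (le_iSup E none)
        · rw [← hEj j hj]
          exact le_iSup E (some j))
    (by
      have hnone (j) : Disjoint (suppS (E none)) (suppS (E (some j))) := by
        by_cases hj : j = i
        · rw [hj, hEi]; exact hdisj.symm
        · rw [hEj j hj]; exact hdB j hj
      rintro (_ | j) (_ | k) hjk
      · exact absurd rfl hjk
      · exact hnone k
      · exact (hnone j).symm
      · have hjk : j ≠ k := fun h => hjk (congrArg some h)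
        by_cases hj : j = i
        · rw [hj, hEi, hEj k (hj ▸ hjk.symm)]
          exact hdA k (hj ▸ hjk.symm)
        · rw [hEj j hj]
          by_cases hk : k = i
          · rw [hk, hEi]; exact (hdA j hj).symm
          · rw [hEj k hk]; exact d.disj hjk)
  have he (S : Set (Fin n)) : (∃ l, S = suppS (e.D l)) ↔ ∃ o, S = suppS (E o) :=
    (Fintype.equivFin (Option (Fin d.r))).symm.exists_congr_left.trans
      (by simp [e, Decomposition.ofFintype])
  obtain ⟨pp, hpp⟩ := d.exists_isInducedPartition
  obtain ⟨pp', hpp'⟩ := e.exists_isInducedPartition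
  refine hd e pp pp' hpp hpp' (.single (.inl ⟨(suppS (d.D i)).toFinset, ?_,
    (suppS A).toFinset, (suppS B).toFinset, ?_, ?_, ?_, ?_, ?_, ?_⟩))
  · rw [hpp.2]
    exact ⟨i, by simp⟩
  · simpa using suppS_nonempty hA
  · simpa using suppS_nonempty hB
  · rwa [Set.disjoint_toFinset]
  · rw [← Finset.coe_inj]; simp [hsupp]
  · rw [← Finset.coe_inj, hpp.1, hpp'.1]
  · ext s
    simp only [Finset.mem_insert, Finset.mem_erase, hpp.2, hpp'.2, he, Option.exists, hE0,
      ← Finset.coe_inj, Set.coe_toFinset, ne_eq]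
    constructor
    · rintro (h | ⟨j, h⟩)
      · exact .inr (.inl h)
      · by_cases hj : j = i
        · exact .inl (by rw [h, hj, hEi])
        · rw [hEj j hj] at h
          exact .inr (.inr ⟨fun hi => hj (d.eq_of_suppS_eq (h.symm.trans hi)), j, h⟩)
    · rintro (h | h | ⟨hi, j, h⟩)
      · exact .inr ⟨i, by rw [hEi, h]⟩
      · exact .inl h
      · refine .inr ⟨j, ?_⟩
        rw [hEj j, h]
        rintro rfl
        exact hi h

end Decomposition

section Transport

variable {n : ℕ}

/-- The image of a pointed partition under a permutation of the coordinates. -/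
def PointedPartition.map (pp : PointedPartition n) (σ : Equiv.Perm (Fin n)) :
    PointedPartition n where
  J0 := pp.J0.map σ.toEmbedding
  parts := pp.parts.map (Finset.mapEmbedding σ.toEmbedding).toEmbedding
  nonempty := by
    simp only [Finset.mem_map]
    rintro _ ⟨J, hJ, rfl⟩
    exact (pp.nonempty J hJ).map
  disj0 := by
    simp only [Finset.mem_map]
    rintro _ ⟨J, hJ, rfl⟩
    exact (Finset.disjoint_map _).2 (pp.disj0 J hJ)
  disj := by
    simp only [Finset.mem_map]
    rintro _ ⟨J, hJ, rfl⟩ _ ⟨K, hK, rfl⟩ hJK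
    exact (Finset.disjoint_map _).2 (pp.disj J hJ K hK fun h => hJK (by rw [h]))
  cover := by
    ext j
    obtain ⟨i, rfl⟩ := σ.surjective j
    have hi := Finset.mem_univ i
    rw [← pp.cover] at hi
    simpa [Finset.mem_sup] using hi

lemma OneStepRefinement.map {Q P : PointedPartition n} (h : OneStepRefinement Q P)
    (σ : Equiv.Perm (Fin n)) : OneStepRefinement (Q.map σ) (P.map σ) := by
  rcases h with ⟨A, hA, B, C, hB, hC, hBC, hu, h0, hp⟩ | ⟨A, hA, B, hB, hBA, h0, hp⟩
  · refine .inl ⟨A.map σ.toEmbedding, Finset.mem_map_of_mem _ hA, B.map σ.toEmbedding,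
      C.map σ.toEmbedding, hB.map, hC.map, (Finset.disjoint_map _).2 hBC, ?_, ?_, ?_⟩
    · rw [← Finset.map_union, hu]
    · simp [PointedPartition.map, h0]
    · simp [PointedPartition.map, hp, Finset.map_insert, Finset.map_erase]
  · refine .inr ⟨A.map σ.toEmbedding, Finset.mem_map_of_mem _ hA, B.map σ.toEmbedding,
      hB.map, Finset.map_ssubset_map.2 hBA, ?_, ?_⟩
    · simp [PointedPartition.map, h0, Finset.map_union]
    · simp [PointedPartition.map, hp, Finset.map_insert, Finset.map_erase, Finset.map_sdiff]

lemma StrictRefines.map {Q P : PointedPartition n} (h : StrictRefines Q P)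
    (σ : Equiv.Perm (Fin n)) : StrictRefines (Q.map σ) (P.map σ) :=
  Relation.TransGen.lift (fun pp : PointedPartition n => pp.map σ)
    (fun _ _ h => OneStepRefinement.map h σ) _ _ h

variable {F : Type*} [Field F] {C C' : Submodule F (Fin n → F)}
  {T : (Fin n → F) ≃ₗ[F] (Fin n → F)} {σ : Equiv.Perm (Fin n)}

lemma IsInducedPartition.map {d : Decomposition C} {pp : PointedPartition n}
    (h : IsInducedPartition d pp) (hσ : ∀ x i, T x (σ i) = x i)
    (hC : C.map (T : (Fin n → F) →ₗ[F] (Fin n → F)) = C') :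
    IsInducedPartition (d.map T σ hσ hC) (pp.map σ) := by
  refine ⟨?_, fun s => ?_⟩
  · rw [← hC, suppS_map hσ, ← Set.image_compl_eq σ.bijective, ← h.1]
    simp [PointedPartition.map]
  · obtain ⟨t, rfl⟩ : ∃ t : Finset (Fin n), s = t.map σ.toEmbedding :=
      ⟨s.map σ.symm.toEmbedding, by ext; simp⟩
    have ht : t.map σ.toEmbedding ∈ (pp.map σ).parts ↔ t ∈ pp.parts :=
      Finset.mem_map' (Finset.mapEmbedding σ.toEmbedding).toEmbedding
    rw [ht, h.2]
    refine exists_congr fun i => ?_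
    simp [Decomposition.map, suppS_map hσ, σ.injective.image_injective.eq_iff]

lemma IsMaximalDecomposition.map {d : Decomposition C} (hd : IsMaximalDecomposition d)
    (hσ : ∀ x i, T x (σ i) = x i)
    (hC : C.map (T : (Fin n → F) →ₗ[F] (Fin n → F)) = C') :
    IsMaximalDecomposition (d.map T σ hσ hC) := by
  intro e pp pp' hpp hpp' href
  have hC' : C'.map (T.symm : (Fin n → F) →ₗ[F] (Fin n → F)) = C := by
    rw [← hC, ← Submodule.map_comp]
    simp
  have hback : (d.map T σ hσ hC).map T.symm σ.symm (symm_apply_perm_symm hσ) hC' = d := by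
    cases d
    simp [Decomposition.map, ← Submodule.map_comp]
  have h := hpp.map (symm_apply_perm_symm hσ) hC'
  rw [hback] at h
  exact hd _ _ _ h (hpp'.map (symm_apply_perm_symm hσ) hC') (href.map σ.symm)

end Transport

lemma IsMaximalDecomposition.pIrreducible {n : ℕ} {H : PartialOrder (Fin n)}
    (hH : ∀ i j : Fin n, H.le i j ↔ i = j) {C : Submodule (ZMod 2) (Fin n → ZMod 2)}
    {d : Decomposition C} (hd : IsMaximalDecomposition d) (i : Fin d.r) :
    PIrreducible H (d.D i) := by
  rintro ⟨C', T, hT, hC', e⟩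
  obtain ⟨σ, hσ⟩ := exists_perm_of_isPIsometry hH hT
  have hσ' := symm_apply_perm_symm hσ
  have hsupp : suppS C' = σ '' suppS (d.D i) := by rw [← hC', suppS_map hσ]
  refine ⟨?_, ?_, ?_⟩
  · change e.r = 1
    have hback : C'.map (T.symm : (Fin n → ZMod 2) →ₗ[ZMod 2] (Fin n → ZMod 2)) = d.D i := by
      rw [← hC', ← Submodule.map_comp]
      simp
    let f : Decomposition (d.D i) := e.map T.symm σ.symm hσ' hback
    change f.r = 1
    have hpos : 0 < f.r := by
      by_contra h0
      have : IsEmpty (Fin f.r) := ⟨fun k => h0 (k.pos)⟩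
      exact d.ne_bot i (by rw [← f.sup_eq, iSup_of_empty])
    by_contra hne
    let a : Fin f.r := ⟨0, hpos⟩
    let b : Fin f.r := ⟨1, by omega⟩
    have hba : b ≠ a := by simp [a, b]
    refine hd.not_exists_split i (f.ne_bot a) (B := ⨆ j, ⨆ _ : j ≠ a, f.D j) ?_ ?_
      (disjoint_suppS_biSup f.disj a)
    · exact ne_bot_of_le_ne_bot (f.ne_bot b) (le_iSup₂_of_le b hba le_rfl)
    · rw [← iSup_split_single, f.sup_eq]
  · change (suppS C').ncard = _
    rw [hsupp, Set.ncard_image_of_injective _ σ.injective]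
  · change (suppS (coSupp C')).ncard = _
    rw [suppS_coSupp, suppS_coSupp, hsupp, ← Set.image_compl_eq σ.bijective,
      Set.ncard_image_of_injective _ σ.injective]

/-- Let `H` be the anti-chain order on `[n]` over `F_2`, so that
`d_H` is the Hamming metric.  If `(C; C_0; C_1, …, C_r)` is a maximal
decomposition of a linear code `C ⊆ F_2^n` and `T` is a linear `H`-isometry with
`T(C) = C'`, then `(C'; T(C_0); T(C_1), …, T(C_r))` is a maximal decomposition
of `C'`; consequently, a maximal decomposition of `C` is also a maximal
`H`-decomposition of `C` (each of its components is `H`-irreducible). -/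
theorem hamming_maximal_decomposition {n : ℕ}
    (H : PartialOrder (Fin n)) (hH : ∀ i j : Fin n, H.le i j ↔ i = j)
    (C : Submodule (ZMod 2) (Fin n → ZMod 2)) (d : Decomposition C)
    (hd : IsMaximalDecomposition d)
    (T : (Fin n → ZMod 2) ≃ₗ[ZMod 2] (Fin n → ZMod 2)) (hT : IsPIsometry H T) :
    (∃ d' : Decomposition
        (Submodule.map (T : (Fin n → ZMod 2) →ₗ[ZMod 2] (Fin n → ZMod 2)) C),
      (∃ h : d'.r = d.r, ∀ i, d'.D i =
        Submodule.map (T : (Fin n → ZMod 2) →ₗ[ZMod 2] (Fin n → ZMod 2))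
          (d.D (Fin.cast h i))) ∧
      IsMaximalDecomposition d') ∧
    ∀ i, PIrreducible H (d.D i) := by
  obtain ⟨σ, hσ⟩ := exists_perm_of_isPIsometry hH hT
  exact ⟨⟨d.map T σ hσ rfl, ⟨rfl, fun _ => rfl⟩, hd.map hσ rfl⟩, hd.pIrreducible hH⟩
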